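/- Let d = 2 and M ≥ 1 be integers. For all integers k ≥ 1 and t ≥ 1, G(t + M, k) ≤ (9/10) · G(t, k). -/

import Mathlib

/-- The vertices of the rooted `d`-ary tree of depth `k`: sequences over `Fin d`
of length at most `k`.  The root is the empty sequence, the children of a vertex
`l` with `l.length < k` are the vertices `l ++ [j]` for `j : Fin d`, and the
leaves are the vertices of length exactly `k`. -/
abbrev Vtx (d k : ℕ) : Type := {l : List (Fin d) // l.length ≤ k}

/-- The root `v₀` of the tree. -/
def rootV (d k : ℕ) : Vtx d k := ⟨[], by simp⟩

/-- `L_M(d,k)`: the set of integer-valued `M`-Lipschitz functions on the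
`d`-ary tree of depth `k` that vanish on all leaves. -/
def LM (d k M : ℕ) : Set (Vtx d k → ℤ) :=
  {f | (∀ v : Vtx d k, v.1.length = k → f v = 0) ∧
       (∀ (l : List (Fin d)) (hl : l.length + 1 ≤ k) (j : Fin d),
         |f ⟨l ++ [j], by simpa using hl⟩ - f ⟨l, Nat.le_of_succ_le hl⟩| ≤ (M : ℤ))}

/-- `G(t,k)`: the number of functions in `L_M(d,k)` whose value at the root is `t`. -/
noncomputable def G (d k M : ℕ) (t : ℤ) : ℕ :=
  Nat.card {f : Vtx d k → ℤ // f ∈ LM d k M ∧ f (rootV d k) = t}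

/-- The probability that a uniformly random element of `L_M(d,k)` takes the
value `t` at the root. -/
noncomputable def PrRoot (d k M : ℕ) (t : ℤ) : ℝ :=
  (G d k M t : ℝ) / (Nat.card (LM d k M) : ℝ)

/-- The subtree hanging below the `j`-th child of the root, as an embedding of vertex sets. -/
def Vtx.cons {d k : ℕ} (j : Fin d) (v : Vtx d k) : Vtx d (k + 1) :=
  ⟨j :: v.1, by simpa using v.2⟩

/-- Glue functions on the subtrees below the children of the root, with value `t` at the root. -/
def glue {d k : ℕ} (t : ℤ) (F : Fin d → Vtx d k → ℤ) : Vtx d (k + 1) → ℤ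
  | ⟨[], _⟩ => t
  | ⟨j :: l, h⟩ => F j ⟨l, by simpa using h⟩

theorem restrict_mem_LM {d k M : ℕ} {f : Vtx d (k + 1) → ℤ} (hf : f ∈ LM d (k + 1) M)
    (j : Fin d) : (fun v => f (Vtx.cons j v)) ∈ LM d k M := by
  refine ⟨fun v hv => hf.1 _ (by simp [Vtx.cons, hv]), fun l hl i => ?_⟩
  exact hf.2 (j :: l) (by simpa using hl) i

theorem glue_mem_LM {d k M : ℕ} {t : ℤ} {F : Fin d → Vtx d k → ℤ}
    (hF : ∀ j, F j ∈ LM d k M) (ht : ∀ j, |F j (rootV d k) - t| ≤ M) :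
    glue t F ∈ LM d (k + 1) M := by
  refine ⟨?_, ?_⟩
  · rintro ⟨l, hl⟩ hv
    cases l with
    | nil => simp at hv
    | cons j l => exact (hF j).1 ⟨l, by simpa using hl⟩ (by simpa using hv)
  · intro l hl i
    cases l with
    | nil => exact ht i
    | cons j l => exact (hF j).2 l (by simpa using hl) i

/-- A function on the tree of depth `k + 1` with root value `t` is the same as a family of functions
on the tree of depth `k`, one for each child of the root, with root values within `M` of `t`. -/
def splitRoot (d k M : ℕ) (t : ℤ) :
    {f : Vtx d (k + 1) → ℤ // f ∈ LM d (k + 1) M ∧ f (rootV d (k + 1)) = t} ≃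
      (Fin d → {f : Vtx d k → ℤ // f ∈ LM d k M ∧ |f (rootV d k) - t| ≤ M}) where
  toFun f j := ⟨fun v => f.1 (Vtx.cons j v), restrict_mem_LM f.2.1 j, by
    have h := f.2.1.2 [] (by simp) j
    have h0 := f.2.2
    unfold rootV at h0
    rw [h0] at h
    exact h⟩
  invFun F := ⟨glue t fun j => (F j).1,
    glue_mem_LM (fun j => (F j).2.1) (fun j => (F j).2.2), rfl⟩
  left_inv f := by
    ext ⟨l, hl⟩
    cases l with
    | nil => exact f.2.2.symm
    | cons j l => rfl
  right_inv F := rfl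

/-- Sort functions by their root value. -/
def sortByRoot (d k M : ℕ) (t : ℤ) :
    {f : Vtx d k → ℤ // f ∈ LM d k M ∧ |f (rootV d k) - t| ≤ M} ≃
      (Σ s : Finset.Icc (t - M) (t + M),
        {f : Vtx d k → ℤ // f ∈ LM d k M ∧ f (rootV d k) = s}) where
  toFun f := ⟨⟨f.1 (rootV d k), by
    have h := abs_le.1 f.2.2
    rw [Finset.mem_Icc]
    constructor <;> linarith⟩, ⟨f.1, f.2.1, rfl⟩⟩
  invFun p := ⟨p.2.1, p.2.2.1, by
    have h := Finset.mem_Icc.1 p.1.2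
    rw [p.2.2.2, abs_le]
    constructor <;> linarith⟩
  left_inv f := rfl
  right_inv := by
    rintro ⟨⟨s, hs⟩, ⟨f, hf, h⟩⟩
    dsimp only at h
    subst h
    rfl

instance finite_fiber (d k M : ℕ) (t : ℤ) :
    Finite {f : Vtx d k → ℤ // f ∈ LM d k M ∧ f (rootV d k) = t} := by
  induction k generalizing t with
  | zero =>
    have : Subsingleton {f : Vtx d 0 → ℤ // f ∈ LM d 0 M ∧ f (rootV d 0) = t} := by
      refine ⟨fun f g => Subtype.ext (funext fun v => ?_)⟩
      have hv : v.1.length = 0 := Nat.le_zero.1 v.2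
      rw [f.2.1.1 v hv, g.2.1.1 v hv]
    infer_instance
  | succ k ih =>
    have : Finite {f : Vtx d k → ℤ // f ∈ LM d k M ∧ |f (rootV d k) - t| ≤ M} :=
      Finite.of_equiv _ (sortByRoot d k M t).symm
    exact Finite.of_equiv _ (splitRoot d k M t).symm

theorem G_succ (d k M : ℕ) (t : ℤ) :
    G d (k + 1) M t = (∑ s ∈ Finset.Icc (t - M) (t + M), G d k M s) ^ d := by
  unfold G
  rw [Nat.card_congr (splitRoot d k M t), Nat.card_fun, Nat.card_congr (sortByRoot d k M t),
    Nat.card_sigma, Nat.card_fin]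
  congr 1
  exact Finset.sum_coe_sort (Finset.Icc (t - (M : ℤ)) (t + M)) fun s => G d k M s

theorem G_zero (d M : ℕ) (t : ℤ) : G d 0 M t = if t = 0 then 1 else 0 := by
  unfold G
  split_ifs with h
  · subst h
    rw [Nat.card_eq_one_iff_unique]
    refine ⟨⟨fun f g => Subtype.ext (funext fun v => ?_)⟩,
      ⟨⟨fun _ => 0, ⟨fun _ _ => rfl, fun l hl => absurd hl (by simp)⟩, rfl⟩⟩⟩
    have hv : v.1.length = 0 := Nat.le_zero.1 v.2
    rw [f.2.1.1 v hv, g.2.1.1 v hv]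
  · have : IsEmpty {f : Vtx d 0 → ℤ // f ∈ LM d 0 M ∧ f (rootV d 0) = t} :=
      ⟨fun f => h (by rw [← f.2.2]; exact f.2.1.1 _ rfl)⟩
    exact Nat.card_of_isEmpty

/-- The sum of `g` over the `n` consecutive integers `a, a + 1, …, a + n - 1`. -/
def seg (g : ℤ → ℝ) (a : ℤ) (n : ℕ) : ℝ := ∑ i ∈ Finset.range n, g (a + i)

theorem seg_add (g : ℤ → ℝ) (a : ℤ) (m n : ℕ) :
    seg g a (m + n) = seg g a m + seg g (a + m) n := by
  simp [seg, Finset.sum_range_add, add_assoc]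

theorem seg_one (g : ℤ → ℝ) (a : ℤ) : seg g a 1 = g a := by simp [seg]

theorem seg_succ (g : ℤ → ℝ) (a : ℤ) (n : ℕ) : seg g a (n + 1) = seg g a n + g (a + n) := by
  rw [seg_add, seg_one]

theorem seg_succ' (g : ℤ → ℝ) (a : ℤ) (n : ℕ) :
    seg g a (n + 1) = g a + seg g (a + 1) n := by
  rw [add_comm n, seg_add, seg_one, Nat.cast_one]

theorem seg_nonneg {g : ℤ → ℝ} (hg : ∀ t, 0 ≤ g t) (a : ℤ) (n : ℕ) : 0 ≤ seg g a n :=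
  Finset.sum_nonneg fun _ _ => hg _

theorem sum_Icc_eq_seg (g : ℤ → ℝ) (t : ℤ) (M : ℕ) :
    ∑ s ∈ Finset.Icc (t - M) (t + M), g s = seg g (t - M) (2 * M + 1) := by
  refine Finset.sum_nbij' (fun s => (s - (t - M)).toNat) (fun i => t - M + i) ?_ ?_ ?_ ?_ ?_
  · intro s hs
    simp only [Finset.mem_Icc, Finset.mem_range] at *
    omega
  · intro i hi
    simp only [Finset.mem_Icc, Finset.mem_range] at *
    omega
  · intro s hs
    simp only [Finset.mem_Icc] at *
    omega
  · intro i hi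
    omega
  · intro s hs
    simp only [Finset.mem_Icc] at *
    congr 1
    omega

/-- The properties of the root counts that are propagated from one depth to the next. -/
structure DecayProfile (M : ℕ) (g : ℤ → ℝ) : Prop where
  nonneg : ∀ t, 0 ≤ g t
  even : ∀ t, g (-t) = g t
  anti : ∀ s t : ℤ, 0 ≤ s → s ≤ t → g t ≤ g s
  decay : ∀ t : ℤ, 1 ≤ t → g (t + M) ≤ 9 / 10 * g t
  block : seg g (M + 1) M ≤ 8972 / 10000 * seg g 1 M

namespace DecayProfile

variable {M : ℕ} {g : ℤ → ℝ}

theorem seg_decay (hg : DecayProfile M g) {a : ℤ} (ha : 1 ≤ a) (n : ℕ) :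
    seg g (a + M) n ≤ 9 / 10 * seg g a n := by
  unfold seg
  rw [Finset.mul_sum]
  refine Finset.sum_le_sum fun i _ => ?_
  have := hg.decay (a + i) (by omega)
  rwa [add_right_comm] at this

theorem seg_anti (hg : DecayProfile M g) {a b : ℤ} (ha : 0 ≤ a) (hab : a ≤ b) (n : ℕ) :
    seg g b n ≤ seg g a n :=
  Finset.sum_le_sum fun i _ => hg.anti _ _ (by omega) (by omega)

theorem seg_reflect (hg : DecayProfile M g) (n : ℕ) : seg g (-n) (n + 1) = seg g 0 (n + 1) := by
  unfold seg
  rw [← Finset.sum_range_reflect]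
  refine Finset.sum_congr rfl fun i hi => ?_
  rw [Finset.mem_range] at hi
  rw [← hg.even]
  congr 1
  omega

/-- The window of radius `M` around `n + 1`, where `n + m + 1 = M`. -/
theorem window_eq (hg : DecayProfile M g) {n m : ℕ} (h : n + m + 1 = M) :
    seg g ((n + 1 : ℤ) - M) (2 * M + 1) =
      seg g 0 (m + 1) + seg g 1 M + seg g (M + 1) (n + 1) := by
  have e : 2 * M + 1 = (m + 1) + M + (n + 1) := by omega
  have e1 : (n + 1 : ℤ) - M = -(m : ℤ) := by omega
  rw [e, seg_add, seg_add, e1, hg.seg_reflect]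
  congr 2
  · congr 1
    push_cast
    ring
  · push_cast
    ring

theorem window_shift_eq (g : ℤ → ℝ) {n m : ℕ} (h : n + m + 1 = M) :
    seg g (n + 1) (2 * M + 1) =
      seg g (n + 1) (m + 1) + seg g (M + 1) M + seg g (M + 1 + M) (n + 1) := by
  have e : 2 * M + 1 = (m + 1) + M + (n + 1) := by omega
  have e1 : (n + 1 : ℤ) + (m + 1 : ℕ) = M + 1 := by omega
  have e2 : (n + 1 : ℤ) + (m + 1 + M : ℕ) = M + 1 + M := by omega
  rw [e, seg_add, seg_add, e1, e2]

/-- The last `m + 1` of the values at `1, …, M` contribute at most their proportional share. -/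
theorem tail_le (hg : DecayProfile M g) {n m : ℕ} (h : n + m + 1 = M) :
    (M : ℝ) * seg g (n + 1) (m + 1) ≤ (m + 1) * seg g 1 M := by
  have e : M = n + (m + 1) := by omega
  have h1 : seg g 1 M = seg g 1 n + seg g (n + 1) (m + 1) := by
    rw [e, seg_add, add_comm (1 : ℤ)]
  have h2 : seg g (n + 1) (m + 1) ≤ (m + 1) * g (n + 1) := by
    have := Finset.sum_le_card_nsmul (Finset.range (m + 1)) (fun i : ℕ => g ((n + 1 : ℤ) + i))
      (g (n + 1)) fun i _ => hg.anti _ _ (by omega) (by omega)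
    simpa [seg] using this
  have h3 : n * g (n + 1) ≤ seg g 1 n := by
    have := Finset.card_nsmul_le_sum (Finset.range n) (fun i : ℕ => g ((1 : ℤ) + i))
      (g (n + 1)) fun i hi => hg.anti _ _ (by omega) (by rw [Finset.mem_range] at hi; omega)
    simpa [seg] using this
  have hM : (M : ℝ) = n + (m + 1) := by exact_mod_cast e
  have h4 := mul_le_mul_of_nonneg_left h2 (Nat.cast_nonneg (α := ℝ) n)
  have h5 := mul_le_mul_of_nonneg_left h3 (by positivity : (0 : ℝ) ≤ m + 1)
  rw [h1, hM]
  nlinarith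

/-- Moving the window from `n + 1` to `n + 1 + M` shrinks its sum by a factor that improves
linearly in `n / M`. -/
theorem window_decay (hg : DecayProfile M g) {n : ℕ} (h : n < M) :
    seg g (n + 1) (2 * M + 1) ≤
      (9486 / 10000 - 257 / 10000 * (n / M)) * seg g ((n + 1 : ℤ) - M) (2 * M + 1) := by
  obtain ⟨m, hm⟩ : ∃ m, n + m + 1 = M := ⟨M - n - 1, by omega⟩
  rw [hg.window_eq hm, window_shift_eq g hm]
  have hM : (0 : ℝ) < M := by exact_mod_cast (by omega : 0 < M)
  have hx : (n / M : ℝ) ≤ 1 := by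
    rw [div_le_one hM]
    exact_mod_cast h.le
  have hx0 : (0 : ℝ) ≤ n / M := by positivity
  have hQ := hg.tail_le hm
  have hmx : ((m : ℝ) + 1) = M * (1 - n / M) := by
    have : (M : ℝ) = n + (m + 1) := by exact_mod_cast (by omega : M = n + (m + 1))
    field_simp
    linarith
  rw [hmx, mul_assoc, mul_le_mul_iff_right₀ hM] at hQ
  have hP : seg g (n + 1) (m + 1) ≤ seg g 0 (m + 1) := hg.seg_anti le_rfl (by omega) _
  have hB := hg.block
  have hU := hg.seg_decay (a := M + 1) (by omega) (n + 1)
  have hU0 := seg_nonneg hg.nonneg (M + 1) (n + 1)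
  have hS0 := seg_nonneg hg.nonneg 1 M
  generalize seg g (n + 1) (m + 1) = Q at *
  generalize seg g 0 (m + 1) = P at *
  generalize seg g 1 M = S at *
  generalize seg g (M + 1) (n + 1) = U at *
  generalize (n / M : ℝ) = x at *
  have k1 : 0 ≤ (9486 / 10000 - 257 / 10000 * x) * (P - Q) :=
    mul_nonneg (by linarith) (by linarith)
  have k2 : 0 ≤ (9486 / 10000 - 257 / 10000 * x - 9 / 10) * U :=
    mul_nonneg (by linarith) (by linarith)
  have k3 : 0 ≤ (514 / 10000 + 257 / 10000 * x) * ((1 - x) * S - Q) :=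
    mul_nonneg (by linarith) (by linarith)
  have k4 : 0 ≤ x * x * S := by positivity
  nlinarith

theorem window_anti (hg : DecayProfile M g) {s t : ℤ} (hs : 0 ≤ s) (hst : s ≤ t) :
    seg g (t - M) (2 * M + 1) ≤ seg g (s - M) (2 * M + 1) := by
  induction t, hst using Int.leInduction with
  | base => exact le_rfl
  | succ t hst ih =>
    refine le_trans ?_ ih
    have h1 := seg_succ g (t - M) (2 * M + 1)
    rw [seg_succ'] at h1
    have h2 : g (t - M + (2 * M + 1 : ℕ)) ≤ g (t - M) := by
      rcases le_total 0 (t - M : ℤ) with h | h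
      · exact hg.anti _ _ h (by omega)
      · rw [← hg.even (t - M)]
        exact hg.anti _ _ (by omega) (by push_cast; omega)
    rw [add_sub_right_comm]
    linarith

theorem window_even (hg : DecayProfile M g) (t : ℤ) :
    seg g (-t - M) (2 * M + 1) = seg g (t - M) (2 * M + 1) := by
  unfold seg
  rw [← Finset.sum_range_reflect]
  refine Finset.sum_congr rfl fun i hi => ?_
  rw [Finset.mem_range] at hi
  rw [← hg.even]
  congr 1
  omega

/-- Window sums around `1, …, M` differ by a factor of at most two. -/
theorem window_one_le (hg : DecayProfile M g) {n : ℕ} (h : n < M) :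
    seg g (1 - M) (2 * M + 1) ≤ 2 * seg g ((n + 1 : ℤ) - M) (2 * M + 1) := by
  obtain ⟨m, hm⟩ : ∃ m, n + m + 1 = M := ⟨M - n - 1, by omega⟩
  obtain ⟨m', rfl⟩ : ∃ m', M = m' + 1 := ⟨M - 1, by omega⟩
  have h0 := hg.window_eq (n := 0) (m := m') (by omega)
  rw [hg.window_eq hm]
  simp only [Nat.cast_zero, zero_add, seg_one] at h0
  rw [h0]
  have h1 := seg_succ g 0 (m' + 1)
  rw [seg_succ'] at h1
  have h2 := seg_succ' g 0 m
  have h3 := seg_nonneg hg.nonneg (0 + 1) m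
  have h4 := seg_nonneg hg.nonneg ((m' + 1 : ℕ) + 1) (n + 1)
  have h5 := hg.anti 0 ((m' + 1 : ℕ) + 1) le_rfl (by omega)
  have h6 := hg.nonneg (0 + (m' + 1 : ℕ))
  simp only [zero_add] at *
  linarith

theorem window_sq_decay (hg : DecayProfile M g) {n : ℕ} (h : n < M) :
    seg g (n + 1) (2 * M + 1) ^ 2 ≤
      (9 / 10 - 48 / 1000 * (n / M)) * seg g ((n + 1 : ℤ) - M) (2 * M + 1) ^ 2 := by
  have hM : (0 : ℝ) < M := by exact_mod_cast (by omega : 0 < M)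
  have hx : (n / M : ℝ) ≤ 1 := by
    rw [div_le_one hM]
    exact_mod_cast h.le
  have hx0 : (0 : ℝ) ≤ n / M := by positivity
  refine (pow_le_pow_left₀ (seg_nonneg hg.nonneg _ _) (hg.window_decay h) 2).trans ?_
  rw [mul_pow]
  refine mul_le_mul_of_nonneg_right ?_ (sq_nonneg _)
  nlinarith

theorem window_sq_decay_of_pos (hg : DecayProfile M g) {t : ℤ} (ht : 1 ≤ t) :
    seg g t (2 * M + 1) ^ 2 ≤ 9 / 10 * seg g (t - M) (2 * M + 1) ^ 2 := by
  have h0 := seg_nonneg hg.nonneg (t - M) (2 * M + 1)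
  rcases le_or_gt t M with h | h
  · obtain ⟨n, rfl⟩ : ∃ n : ℕ, t = n + 1 := ⟨(t - 1).toNat, by omega⟩
    refine (hg.window_sq_decay (by omega)).trans (mul_le_mul_of_nonneg_right ?_ (sq_nonneg _))
    have : (0 : ℝ) ≤ n / M := by positivity
    linarith
  · have h1 := hg.seg_decay (a := t - M) (by omega) (2 * M + 1)
    rw [sub_add_cancel] at h1
    have h2 := pow_le_pow_left₀ (seg_nonneg hg.nonneg _ _) h1 2
    nlinarith [sq_nonneg (seg g (t - M) (2 * M + 1))]

theorem sum_window_sq_decay_of_two_le (hg : DecayProfile M g) (hM : 2 ≤ M) :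
    ∑ n ∈ Finset.range M, seg g (n + 1) (2 * M + 1) ^ 2 ≤
      8972 / 10000 * ∑ n ∈ Finset.range M, seg g ((n + 1 : ℤ) - M) (2 * M + 1) ^ 2 := by
  have hM' : (2 : ℝ) ≤ M := by exact_mod_cast hM
  set H := seg g (1 - M) (2 * M + 1) ^ 2 with hH
  have hH0 : 0 ≤ H := sq_nonneg _
  have key : ∀ n ∈ Finset.range M, seg g (n + 1) (2 * M + 1) ^ 2 ≤
      8972 / 10000 * seg g ((n + 1 : ℤ) - M) (2 * M + 1) ^ 2 +
        (28 / 10000 - 12 / 1000 / M * n) * H := by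
    intro n hn
    rw [Finset.mem_range] at hn
    have h1 := hg.window_sq_decay hn
    have h2 := pow_le_pow_left₀ (seg_nonneg hg.nonneg _ _) (hg.window_one_le hn) 2
    have h3 : seg g ((n + 1 : ℤ) - M) (2 * M + 1) ^ 2 ≤ H :=
      pow_le_pow_left₀ (seg_nonneg hg.nonneg _ _)
        (hg.window_anti (s := 1) (by omega) (by omega)) 2
    rw [← hH, mul_pow] at h2
    have hx0 : (0 : ℝ) ≤ n / M := by positivity
    have e : (12 / 1000 / M * n : ℝ) = 12 / 1000 * (n / M) := by ring
    rw [e]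
    have h4 := mul_le_mul_of_nonneg_left h2 hx0
    linarith
  refine (Finset.sum_le_sum key).trans ?_
  rw [Finset.sum_add_distrib, ← Finset.mul_sum, ← Finset.sum_mul, Finset.sum_sub_distrib,
    ← Finset.mul_sum]
  have hs : (∑ n ∈ Finset.range M, (n : ℝ)) = M * (M - 1) / 2 := by
    have := Finset.sum_range_id_mul_two M
    have h2 : ((∑ n ∈ Finset.range M, n : ℕ) : ℝ) * 2 = M * ((M - 1 : ℕ) : ℝ) := by
      exact_mod_cast this
    rw [Nat.cast_sub (by omega), Nat.cast_one, Nat.cast_sum] at h2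
    linarith
  have hc : (∑ _n ∈ Finset.range M, (28 / 10000 : ℝ)) -
      12 / 1000 / M * ∑ n ∈ Finset.range M, (n : ℝ) ≤ 0 := by
    rw [hs]
    have e : (12 / 1000 / M * (M * (M - 1) / 2) : ℝ) = 6 / 1000 * (M - 1) := by
      field_simp
      ring
    rw [e]
    simp only [Finset.sum_const, Finset.card_range, nsmul_eq_mul]
    linarith
  have := mul_nonpos_of_nonpos_of_nonneg hc hH0
  linarith

theorem window_sq_decay_of_eq_one {g : ℤ → ℝ} (hg : DecayProfile 1 g) :
    seg g 1 3 ^ 2 ≤ 8972 / 10000 * seg g 0 3 ^ 2 := by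
  have h1 := hg.block
  have h2 := hg.decay 2 (by norm_num)
  have h3 := hg.anti 0 1 le_rfl (by norm_num)
  have p1 := hg.nonneg 1
  have p2 := hg.nonneg 2
  have p3 := hg.nonneg 3
  norm_num [seg_one] at h1 h2
  have e1 : seg g 1 3 = g 1 + g 2 + g 3 := by simp [seg, Finset.sum_range_succ]
  have e0 : seg g 0 3 = g 0 + g 1 + g 2 := by simp [seg, Finset.sum_range_succ]
  rw [e1, e0]
  have h : g 1 + g 2 + g 3 ≤ 94 / 100 * (g 0 + g 1 + g 2) := by linarith
  have := pow_le_pow_left₀ (by linarith) h 2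
  nlinarith [sq_nonneg (g 0 + g 1 + g 2)]

theorem sum_window_sq_decay (hg : DecayProfile M g) (hM : 1 ≤ M) :
    ∑ n ∈ Finset.range M, seg g (n + 1) (2 * M + 1) ^ 2 ≤
      8972 / 10000 * ∑ n ∈ Finset.range M, seg g ((n + 1 : ℤ) - M) (2 * M + 1) ^ 2 := by
  rcases hM.eq_or_lt with rfl | h
  · simpa using hg.window_sq_decay_of_eq_one
  · exact hg.sum_window_sq_decay_of_two_le h

theorem window_sq (hg : DecayProfile M g) (hM : 1 ≤ M) :
    DecayProfile M fun t => seg g (t - M) (2 * M + 1) ^ 2 where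
  nonneg _ := sq_nonneg _
  even t := by simp only [hg.window_even]
  anti s t hs hst := pow_le_pow_left₀ (seg_nonneg hg.nonneg _ _) (hg.window_anti hs hst) 2
  decay t ht := by
    simp only [add_sub_cancel_right]
    exact hg.window_sq_decay_of_pos ht
  block := by
    refine le_of_eq_of_le ?_ ((hg.sum_window_sq_decay hM).trans_eq ?_)
    · refine Finset.sum_congr rfl fun n _ => ?_
      have e : (M + 1 + n : ℤ) - M = n + 1 := by ring
      simp only [e]
    · congr 1
      refine Finset.sum_congr rfl fun n _ => ?_
      simp only [add_comm (1 : ℤ)]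

end DecayProfile

theorem decayProfile_G (M : ℕ) (hM : 1 ≤ M) (k : ℕ) :
    DecayProfile M fun t => (G 2 k M t : ℝ) := by
  induction k with
  | zero =>
    have h0 : ∀ t : ℤ, 1 ≤ t → (G 2 0 M t : ℝ) = 0 := fun t ht => by
      rw [G_zero, if_neg (by omega), Nat.cast_zero]
    refine ⟨fun _ => Nat.cast_nonneg _, fun t => by simp [G_zero], fun s t hs hst => ?_,
      fun t ht => ?_, ?_⟩
    · rcases eq_or_lt_of_le (hs.trans hst) with rfl | h
      · rw [le_antisymm hst hs]
      · simp only [h0 t h, Nat.cast_nonneg]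
    · simp only [h0 t ht, h0 (t + M) (by omega), mul_zero, le_refl]
    · refine le_of_eq_of_le (Finset.sum_eq_zero fun i _ => h0 _ (by omega)) ?_
      exact mul_nonneg (by norm_num) (seg_nonneg (fun _ => Nat.cast_nonneg _) _ _)
  | succ k ih =>
    have e : (fun t => (G 2 (k + 1) M t : ℝ)) =
        fun t => seg (fun s => (G 2 k M s : ℝ)) (t - M) (2 * M + 1) ^ 2 := by
      funext t
      rw [G_succ, ← sum_Icc_eq_seg, Nat.cast_pow, Nat.cast_sum]
    rw [e]
    exact ih.window_sq hM

/-- **Exponential decay, `d = 2`.**  For all `k, t ≥ 1`,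
`G(t+M,k) ≤ (9/10) * G(t,k)`. -/
theorem G_exp_decay_d_eq_two (d M : ℕ) (hd : d = 2) (hM : 1 ≤ M) (k : ℕ)
    (hk : 1 ≤ k) (t : ℤ) (ht : 1 ≤ t) :
    (G d k M (t + M) : ℝ) ≤ (9 / 10 : ℝ) * (G d k M t : ℝ) := by
  subst hd
  exact (decayProfile_G M hM k).decay t ht
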